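/- For every integer s ≥ 3, the ratio f_{s+1,s+2}(n)/f_{s,s+2}(n) tends to infinity as n → ∞. -/

import Mathlib

/-- The Erdős–Rogers function `f_{s,t}(n)`: the minimum over all `K_t`-free graphs `G`
on `n` vertices of the maximum size of a vertex subset inducing a `K_s`-free subgraph. -/
noncomputable def erdosRogers (s t n : ℕ) : ℕ :=
  sInf { k : ℕ | ∃ G : SimpleGraph (Fin n), G.CliqueFree t ∧
    k = sSup { m : ℕ | ∃ A : Finset (Fin n), A.card = m ∧
      (G.induce (A : Set (Fin n))).CliqueFree s } }


/-- Slope condition. -/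
def ERRel {F : Type*} [CommRing F] (a b c d e f : F) : F :=
  (d - a) * (f - b) * (e - c) - (d - b) * (f - c) * (e - a)

/-- Valid index tuples: edges of a quadrangle sharing a vertex have distinct labels. -/
def ERValid {ι : Type*} (a b c d e f : ι) : Prop :=
  (a ≠ b ∧ a ≠ c ∧ b ≠ c) ∧ (a ≠ d ∧ a ≠ e ∧ d ≠ e) ∧ (b ≠ d ∧ b ≠ f ∧ d ≠ f) ∧
    (c ≠ e ∧ c ≠ f ∧ e ≠ f)

lemma er_geom {F : Type*} [Field F] {x1 y1 x2 y2 x3 y3 x4 y4 a b c d e f : F}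
    (h12 : y1 - a * x1 = y2 - a * x2) (h13 : y1 - b * x1 = y3 - b * x3)
    (h14 : y1 - c * x1 = y4 - c * x4) (h23 : y2 - d * x2 = y3 - d * x3)
    (h24 : y2 - e * x2 = y4 - e * x4) (h34 : y3 - f * x3 = y4 - f * x4)
    (n2 : x2 ≠ x1) (n3 : x3 ≠ x1) (n4 : x4 ≠ x1) : ERRel a b c d e f = 0 := by
  have e1 : (x2 - x1) * (d - a) = (x3 - x1) * (d - b) := by linear_combination h13 - h12 - h23
  have e2 : (x3 - x1) * (f - b) = (x4 - x1) * (f - c) := by linear_combination h14 - h13 - h34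
  have e3 : (x4 - x1) * (e - c) = (x2 - x1) * (e - a) := by linear_combination h12 - h14 + h24
  have h : ((x2 - x1) * (x3 - x1) * (x4 - x1)) * ERRel a b c d e f = 0 := by
    unfold ERRel
    linear_combination (x3 - x1) * (f - b) * ((x4 - x1) * (e - c)) * e1 +
      (x3 - x1) * (d - b) * ((x4 - x1) * (e - c)) * e2 +
      (x3 - x1) * (d - b) * (x4 - x1) * (f - c) * e3
  rcases mul_eq_zero.1 h with h | h
  · simp [sub_ne_zero.2 n2, sub_ne_zero.2 n3, sub_ne_zero.2 n4] at h
  · exact h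

lemma er_exists_ne {p r : ℕ} [Fact p.Prime] (hp : 2 < p) (hr : r < p)
    {a b c d e f : Fin r} (h : ERValid a b c d e f) :
    ∃ v : Fin r → ZMod p, ERRel (v a) (v b) (v c) (v d) (v e) (v f) ≠ 0 := by
  obtain ⟨⟨h1, h2, h3⟩, ⟨h4, h5, h6⟩, ⟨h7, h8, h9⟩, ⟨h10, h11, h12⟩⟩ := h
  let w : Fin r → ZMod p := fun i => ((i.val + 1 : ℕ) : ZMod p)
  have winj : ∀ i j, i ≠ j → w i - w j ≠ 0 := by
    intro i j hij h
    apply hij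
    have h' : ((i.val + 1 : ℕ) : ZMod p) = ((j.val + 1 : ℕ) : ZMod p) := sub_eq_zero.1 h
    rw [ZMod.natCast_eq_natCast_iff] at h'
    have := Nat.ModEq.add_right_cancel' 1 h'
    have := Nat.ModEq.eq_of_lt_of_lt this (by omega) (by omega)
    exact Fin.ext this
  have w0 : ∀ i, w i ≠ 0 := by
    intro i h
    have h' : ((i.val + 1 : ℕ) : ZMod p) = 0 := h
    rw [ZMod.natCast_eq_zero_iff] at h'
    have := Nat.le_of_dvd (by omega) h'
    omega
  have w0' : ∀ i, 0 - w i ≠ 0 := by intro i; rw [zero_sub]; exact neg_ne_zero.2 (w0 i)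
  have w0'' : ∀ i, w i - 0 ≠ 0 := by intro i; rw [sub_zero]; exact (w0 i)
  by_cases c1 : e = b ∧ c = d
  · obtain ⟨rfl, rfl⟩ := c1
    by_cases c2 : a = f
    · subst c2
      refine ⟨w, ?_⟩
      have : ERRel (w a) (w e) (w c) (w c) (w e) (w a) =
          2 * ((w c - w a) * (w a - w e) * (w e - w c)) := by unfold ERRel; ring
      rw [this]
      have two : (2 : ZMod p) ≠ 0 := by
        intro h
        have h' : ((2 : ℕ) : ZMod p) = 0 := by exact_mod_cast h
        rw [ZMod.natCast_eq_zero_iff] at h'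
        have := Nat.le_of_dvd (by omega) h'
        omega
      exact mul_ne_zero two (mul_ne_zero (mul_ne_zero (winj _ _ h2.symm) (winj _ _ h1))
        (winj _ _ h3))
    · refine ⟨fun i => if i = f ∨ i = c then 0 else w i, ?_⟩
      unfold ERRel
      simp only [h2, h3, h8, h9, c2, true_or, or_true, or_false, if_true, if_false]
      simp [w0]
  · refine ⟨fun i => if i = b ∨ i = d then 0 else w i, ?_⟩
    unfold ERRel
    simp only [h1, h4, h8.symm, h9.symm, true_or, or_true, or_false, if_true, if_false,
      sub_self, zero_mul, sub_zero]
    refine mul_ne_zero (mul_ne_zero (w0' _) (w0 _)) ?_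
    simp only [h6.symm, h3.symm, or_false, false_or]
    by_cases k1 : e = b
    · have k2 : c ≠ d := fun h => c1 ⟨k1, h⟩
      simp [k1, k2, w0]
    · by_cases k2 : c = d
      · simp [k1, k2, w0]
      · simp only [k1, k2, if_false]
        exact winj _ _ h10.symm

lemma er_slopes {p r : ℕ} [Fact p.Prime] (hp : 2 < p) (hr : 3 * r ^ 6 + r ^ 2 < p) :
    ∃ v : Fin r → ZMod p, Function.Injective v ∧
      ∀ a b c d e f, ERValid a b c d e f →
        ERRel (v a) (v b) (v c) (v d) (v e) (v f) ≠ 0 := by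
  classical
  have hrp : r < p := by nlinarith [sq_nonneg r, Nat.zero_le (r^6), Nat.le_self_pow (n := 2) (by norm_num) r]
  let T := Fin r × Fin r × Fin r × Fin r × Fin r × Fin r
  let X : Fin r → MvPolynomial (Fin r) (ZMod p) := MvPolynomial.X
  let Q : T → MvPolynomial (Fin r) (ZMod p) := fun t =>
    if ERValid t.1 t.2.1 t.2.2.1 t.2.2.2.1 t.2.2.2.2.1 t.2.2.2.2.2 then
      ERRel (X t.1) (X t.2.1) (X t.2.2.1) (X t.2.2.2.1) (X t.2.2.2.2.1) (X t.2.2.2.2.2) else 1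
  let Q2 : Fin r × Fin r → MvPolynomial (Fin r) (ZMod p) := fun t =>
    if t.1 ≠ t.2 then X t.1 - X t.2 else 1
  have evX : ∀ (v : Fin r → ZMod p) i, MvPolynomial.eval v (X i) = v i := fun v i =>
    MvPolynomial.eval_X _
  have hQ : ∀ t, Q t ≠ 0 := by
    intro t
    by_cases h : ERValid t.1 t.2.1 t.2.2.1 t.2.2.2.1 t.2.2.2.2.1 t.2.2.2.2.2
    · obtain ⟨v, hv⟩ := er_exists_ne hp hrp h
      intro h0
      apply hv
      have := congrArg (MvPolynomial.eval v) h0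
      simpa [Q, h, ERRel, evX] using this
    · simp [Q, h]
  have hQ2 : ∀ t, Q2 t ≠ 0 := by
    intro t
    by_cases h : t.1 = t.2
    · simp [Q2, h]
    · simp only [Q2, ne_eq, h, not_false_eq_true, if_true]
      exact fun h' => h (MvPolynomial.X_injective (sub_eq_zero.1 h'))
  have dX : ∀ i j, (X i - X j).totalDegree ≤ 1 := by
    intro i j
    refine (MvPolynomial.totalDegree_sub _ _).trans ?_
    simp [X, MvPolynomial.totalDegree_X]
  have d3 : ∀ i j k l m n, ((X i - X j) * (X k - X l) * (X m - X n)).totalDegree ≤ 3 := by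
    intro i j k l m n
    have a1 := MvPolynomial.totalDegree_mul ((X i - X j) * (X k - X l)) (X m - X n)
    have a2 := MvPolynomial.totalDegree_mul (X i - X j) (X k - X l)
    have := dX i j; have := dX k l; have := dX m n
    omega
  have dQ : ∀ t, (Q t).totalDegree ≤ 3 := by
    intro t
    by_cases h : ERValid t.1 t.2.1 t.2.2.1 t.2.2.2.1 t.2.2.2.2.1 t.2.2.2.2.2
    · simp only [Q, h, if_true, ERRel]
      exact (MvPolynomial.totalDegree_sub _ _).trans (max_le (d3 _ _ _ _ _ _) (d3 _ _ _ _ _ _))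
    · simp [Q, h]
  have dQ2 : ∀ t, (Q2 t).totalDegree ≤ 1 := by
    intro t
    by_cases h : t.1 = t.2
    · simp [Q2, h]
    · simp only [Q2, ne_eq, h, not_false_eq_true, if_true]
      exact dX _ _
  let P := (∏ t, Q t) * ∏ t, Q2 t
  have hP : P ≠ 0 := mul_ne_zero (Finset.prod_ne_zero_iff.2 fun t _ => hQ t)
    (Finset.prod_ne_zero_iff.2 fun t _ => hQ2 t)
  have dP : P.totalDegree ≤ 3 * r ^ 6 + r ^ 2 := by
    refine (MvPolynomial.totalDegree_mul _ _).trans (add_le_add ?_ ?_)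
    · refine (MvPolynomial.totalDegree_finsetProd _ _).trans
        ((Finset.sum_le_sum fun t _ => dQ t).trans (le_of_eq ?_))
      simp [T]; ring
    · refine (MvPolynomial.totalDegree_finsetProd _ _).trans
        ((Finset.sum_le_sum fun t _ => dQ2 t).trans (le_of_eq ?_))
      simp; ring
  have sz := MvPolynomial.schwartz_zippel_totalDegree hP (Finset.univ : Finset (ZMod p))
  have : ∃ v : Fin r → ZMod p, MvPolynomial.eval v P ≠ 0 := by
    by_contra hcon
    push Not at hcon
    have hp0 : (0 : ℚ≥0) < p := by exact_mod_cast (by omega : 0 < p)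
    simp only [hcon, Finset.filter_true, Finset.card_univ, ZMod.card, Fintype.piFinset_univ,
      Fintype.card_pi, Finset.prod_const, Fintype.card_fin] at sz
    push_cast at sz
    rw [div_self (by positivity), one_le_div hp0] at sz
    have : p ≤ P.totalDegree := by exact_mod_cast sz
    omega
  obtain ⟨v, hv⟩ := this
  simp only [P, map_mul, map_prod] at hv
  obtain ⟨hv1, hv2⟩ := mul_ne_zero_iff.1 hv
  refine ⟨v, ?_, ?_⟩
  · intro i j hij
    by_contra hne
    have := Finset.prod_ne_zero_iff.1 hv2 (i, j) (Finset.mem_univ _)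
    simp [Q2, hne, evX, hij] at this
  · intro a b c d e f h
    have := Finset.prod_ne_zero_iff.1 hv1 (a, b, c, d, e, f) (Finset.mem_univ _)
    simpa [Q, h, evX, ERRel] using this

/-- The random-like graph: points of the affine plane, joined when they lie on a common line with
one of the chosen slopes and get different colours on that line. -/
def erGraph {p r s : ℕ} (v : Fin r → ZMod p) (c : (ZMod p × ZMod p) × Fin r → Fin s) :
    SimpleGraph (ZMod p × ZMod p) where
  Adj u w := ∃ i, u.2 - v i * u.1 = w.2 - v i * w.1 ∧ c (u, i) ≠ c (w, i)
  symm := ⟨fun _ _ ⟨i, h1, h2⟩ => ⟨i, h1.symm, h2.symm⟩⟩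
  loopless := ⟨fun _ ⟨_, _, h2⟩ => h2 rfl⟩

lemma er_fst_ne {F : Type*} [Field F] {u w : F × F} (huw : u ≠ w) {m : F}
    (h : u.2 - m * u.1 = w.2 - m * w.1) : u.1 ≠ w.1 := by
  intro h1
  apply huw
  refine Prod.ext h1 ?_
  rw [h1] at h
  exact sub_left_injective h

lemma er_uniq {F : Type*} [Field F] {u w : F × F} (huw : u ≠ w) {m n : F}
    (h : u.2 - m * u.1 = w.2 - m * w.1) (h' : u.2 - n * u.1 = w.2 - n * w.1) : m = n := by
  have h1 := er_fst_ne huw h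
  have : (m - n) * (u.1 - w.1) = 0 := by linear_combination h' - h
  rcases mul_eq_zero.1 this with h2 | h2
  · exact sub_eq_zero.1 h2
  · exact absurd (sub_eq_zero.1 h2) h1

lemma er_cliqueFree {p r s : ℕ} [Fact p.Prime] (hs : 2 ≤ s) (v : Fin r → ZMod p)
    (vinj : Function.Injective v)
    (hv : ∀ a b c d e f, ERValid a b c d e f → ERRel (v a) (v b) (v c) (v d) (v e) (v f) ≠ 0)
    (c : (ZMod p × ZMod p) × Fin r → Fin s) : (erGraph v c).CliqueFree (s + 2) := by
  classical
  intro Q hQ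
  obtain ⟨hcl, hcard⟩ := hQ
  let β : Fin r → ZMod p × ZMod p → ZMod p := fun i u => u.2 - v i * u.1
  have adj : ∀ u ∈ Q, ∀ w ∈ Q, u ≠ w → ∃ i, β i u = β i w ∧ c (u, i) ≠ c (w, i) :=
    fun u hu w hw huw => hcl hu hw huw
  have uniq : ∀ u w i j, u ≠ w → β i u = β i w → β j u = β j w → i = j :=
    fun u w i j huw h h' => vinj (er_uniq huw h h')
  have quad : ∀ a1 ∈ Q, ∀ a2 ∈ Q, ∀ a3 ∈ Q, ∀ a4 ∈ Q, a1 ≠ a2 → a1 ≠ a3 → a1 ≠ a4 → a2 ≠ a3 →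
      a2 ≠ a4 → a3 ≠ a4 → ∃ i, (β i a1 = β i a2 ∧ β i a1 = β i a3) ∨
        (β i a1 = β i a2 ∧ β i a1 = β i a4) ∨ (β i a1 = β i a3 ∧ β i a1 = β i a4) ∨
        (β i a2 = β i a3 ∧ β i a2 = β i a4) := by
    intro a1 h1 a2 h2 a3 h3 a4 h4 n12 n13 n14 n23 n24 n34
    obtain ⟨i12, e12, -⟩ := adj a1 h1 a2 h2 n12
    obtain ⟨i13, e13, -⟩ := adj a1 h1 a3 h3 n13
    obtain ⟨i14, e14, -⟩ := adj a1 h1 a4 h4 n14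
    obtain ⟨i23, e23, -⟩ := adj a2 h2 a3 h3 n23
    obtain ⟨i24, e24, -⟩ := adj a2 h2 a4 h4 n24
    obtain ⟨i34, e34, -⟩ := adj a3 h3 a4 h4 n34
    have hnv : ¬ ERValid i12 i13 i14 i23 i24 i34 := by
      intro hval
      exact hv _ _ _ _ _ _ hval (er_geom e12 e13 e14 e23 e24 e34 (er_fst_ne n12 e12).symm
        (er_fst_ne n13 e13).symm (er_fst_ne n14 e14).symm)
    by_contra hcon
    push Not at hcon
    apply hnv
    refine ⟨⟨?_, ?_, ?_⟩, ⟨?_, ?_, ?_⟩, ⟨?_, ?_, ?_⟩, ⟨?_, ?_, ?_⟩⟩ <;> rintro rfl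
    · exact (hcon _).1 e12 e13
    · exact (hcon _).2.1 e12 e14
    · exact (hcon _).2.2.1 e13 e14
    · exact (hcon _).1 e12 (e12.trans e23)
    · exact (hcon _).2.1 e12 (e12.trans e24)
    · exact (hcon _).2.2.2 e23 e24
    · exact (hcon _).1 (e13.trans e23.symm) e13
    · exact (hcon _).2.2.1 e13 (e13.trans e34)
    · exact (hcon _).2.2.2 e23 (e23.trans e34)
    · exact (hcon _).2.1 (e14.trans e24.symm) e14
    · exact (hcon _).2.2.1 (e14.trans e34.symm) e14
    · exact (hcon _).2.2.2 (e24.trans e34.symm) e24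
  have triple : ∃ i, ∃ x ∈ Q, ∃ y ∈ Q, ∃ z ∈ Q, x ≠ y ∧ x ≠ z ∧ y ≠ z ∧
      β i x = β i y ∧ β i x = β i z := by
    obtain ⟨R, hRQ, hR⟩ := Finset.exists_subset_card_eq (s := Q) (n := 4) (by omega)
    obtain ⟨a1, a2, a3, a4, n12, n13, n14, n23, n24, n34, rfl⟩ := Finset.card_eq_four.1 hR
    have h1 : a1 ∈ Q := hRQ (by simp)
    have h2 : a2 ∈ Q := hRQ (by simp)
    have h3 : a3 ∈ Q := hRQ (by simp)
    have h4 : a4 ∈ Q := hRQ (by simp)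
    obtain ⟨i, h | h | h | h⟩ := quad a1 h1 a2 h2 a3 h3 a4 h4 n12 n13 n14 n23 n24 n34
    · exact ⟨i, a1, h1, a2, h2, a3, h3, n12, n13, n23, h⟩
    · exact ⟨i, a1, h1, a2, h2, a4, h4, n12, n14, n24, h⟩
    · exact ⟨i, a1, h1, a3, h3, a4, h4, n13, n14, n34, h⟩
    · exact ⟨i, a2, h2, a3, h3, a4, h4, n23, n24, n34, h⟩
  obtain ⟨i, x, hx, y, hy, z, hz, nxy, nxz, nyz, exy, exz⟩ := triple
  have key : (Q.filter fun u => ¬ β i u = β i x).card ≤ 1 := by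
    rw [Finset.card_le_one]
    intro u hu w hw
    rw [Finset.mem_filter] at hu hw
    by_contra huw
    obtain ⟨j, ej, -⟩ := adj u hu.1 w hw.1 huw
    have nboth : ∀ g h, g ≠ h → β i g = β i x → β i h = β i x → β j g = β j u → β j h ≠ β j u := by
      intro g h hgh eg eh eg' eh'
      have := uniq g h i j hgh (eg.trans eh.symm) (eg'.trans eh'.symm)
      subst this
      exact hu.2 (eg'.symm.trans eg)
    have fin : ∀ g ∈ Q, ∀ h ∈ Q, g ≠ h → β i g = β i x → β i h = β i x → β j g ≠ β j u →
        β j h ≠ β j u → False := by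
      intro g hg h hh hgh eg eh eg' eh'
      have nug : u ≠ g := fun h' => hu.2 (h' ▸ eg)
      have nuh : u ≠ h := fun h' => hu.2 (h' ▸ eh)
      have nwg : w ≠ g := fun h' => hw.2 (h' ▸ eg)
      have nwh : w ≠ h := fun h' => hw.2 (h' ▸ eh)
      obtain ⟨k, h' | h' | h' | h'⟩ :=
        quad u hu.1 w hw.1 g hg h hh huw nug nuh nwg nwh hgh
      · have := uniq u w k j huw h'.1 ej
        subst this
        exact eg' h'.2.symm
      · have := uniq u w k j huw h'.1 ej
        subst this
        exact eh' h'.2.symm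
      · have := uniq g h k i hgh (h'.1.symm.trans h'.2) (eg.trans eh.symm)
        subst this
        exact hu.2 (h'.1.trans eg)
      · have := uniq g h k i hgh (h'.1.symm.trans h'.2) (eg.trans eh.symm)
        subst this
        exact hw.2 (h'.1.trans eg)
    by_cases c1 : β j x = β j u
    · exact fin y hy z hz nyz exy.symm exz.symm
        (nboth x y nxy rfl exy.symm c1) (nboth x z nxz rfl exz.symm c1)
    · by_cases c2 : β j y = β j u
      · exact fin x hx z hz nxz rfl exz.symm c1 (nboth y z nyz exy.symm exz.symm c2)
      · exact fin x hx y hy nxy rfl exy.symm c1 c2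
  have hL : s + 1 ≤ (Q.filter fun u => β i u = β i x).card := by
    have := Finset.card_filter_add_card_filter_not (s := Q) (fun u => β i u = β i x)
    omega
  obtain ⟨u, hu, w, hw, huw, hc⟩ := Finset.exists_ne_map_eq_of_card_lt_of_maps_to
    (s := Q.filter fun u => β i u = β i x) (t := (Finset.univ : Finset (Fin s)))
    (f := fun u => c (u, i)) (by simp; omega) (by intro _ _; simp)
  rw [Finset.mem_filter] at hu hw
  obtain ⟨k, ek, hk⟩ := adj u hu.1 w hw.1 huw
  have := uniq u w k i huw ek (hu.2.trans hw.2.symm)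
  subst this
  exact hk hc

lemma er_missing {p r s : ℕ} (v : Fin r → ZMod p)
    (c : (ZMod p × ZMod p) × Fin r → Fin s) (A : Finset (ZMod p × ZMod p))
    (hA : (erGraph v c).CliqueFreeOn A s) :
    ∃ e : Fin r × ZMod p → Fin s, ∀ u ∈ A, ∀ i, c (u, i) ≠ e (i, u.2 - v i * u.1) := by
  classical
  by_contra hcon
  have h1 : ¬ ∀ x : Fin r × ZMod p, ∃ k : Fin s, ∀ u ∈ A, u.2 - v x.1 * u.1 = x.2 →
      c (u, x.1) ≠ k := by
    intro h
    choose e he using h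
    exact hcon ⟨e, fun u hu i => he (i, u.2 - v i * u.1) u hu rfl⟩
  push Not at h1
  obtain ⟨⟨i, b⟩, h⟩ := h1
  choose w hw1 hw2 hw3 using h
  have winj : Function.Injective w := by
    intro k l hkl
    rw [← hw3 k, ← hw3 l, hkl]
  refine hA (t := Finset.univ.image w) ?_ ⟨?_, ?_⟩
  · intro x hx
    simp only [Finset.coe_image, Finset.coe_univ, Set.image_univ, Set.mem_range] at hx
    obtain ⟨k, rfl⟩ := hx
    exact hw1 k
  · intro x hx y hy hxy
    simp only [Finset.coe_image, Finset.coe_univ, Set.image_univ, Set.mem_range] at hx hy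
    obtain ⟨k, rfl⟩ := hx
    obtain ⟨l, rfl⟩ := hy
    refine ⟨i, (hw2 k).trans (hw2 l).symm, ?_⟩
    intro h
    apply hxy
    have h' : k = l := by rw [← hw3 k, ← hw3 l]; exact h
    rw [h']
  · rw [Finset.card_image_of_injective _ winj]; simp

lemma er_count {p r s C : ℕ} [Fact p.Prime] (hs : 2 ≤ s) (v : Fin r → ZMod p)
    (h2 : p ^ (2 * C) < 2 ^ r) (hC : 2 * s * (s - 1) ^ C ≤ s ^ C) :
    ∃ c : (ZMod p × ZMod p) × Fin r → Fin s, ∀ A : Finset (ZMod p × ZMod p),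
      A.card = C * p → ¬ (erGraph v c).CliqueFreeOn A s := by
  classical
  have hp0 : 0 < p := (Fact.out : p.Prime).pos
  by_contra hcon
  push Not at hcon
  let V := ZMod p × ZMod p
  have hV : Fintype.card V = p * p := by simp [V, ZMod.card]
  let B : Finset V → (Fin r × ZMod p → Fin s) → Finset (V × Fin r → Fin s) := fun A e =>
    Fintype.piFinset fun x => if x.1 ∈ A then Finset.univ.erase (e (x.2, x.1.2 - v x.2 * x.1.1))
      else Finset.univ
  have hB : ∀ A e, A.card = C * p → (B A e).card * s ^ (C * p * r) =
      (s - 1) ^ (C * p * r) * s ^ (p * p * r) := by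
    intro A e hA
    have hle : C * p ≤ p * p := by rw [← hA, ← hV]; exact Finset.card_le_univ A
    have : (B A e).card = ((s - 1) ^ (C * p) * s ^ (p * p - C * p)) ^ r := by
      simp only [B, Fintype.card_piFinset]
      rw [Fintype.prod_prod_type_right]
      have : ∀ i : Fin r, ∏ x : V, (if x ∈ A then Finset.univ.erase (e (i, x.2 - v i * x.1))
          else (Finset.univ : Finset (Fin s))).card = (s - 1) ^ (C * p) * s ^ (p * p - C * p) := by
        intro i
        have : ∀ x : V, (if x ∈ A then Finset.univ.erase (e (i, x.2 - v i * x.1))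
          else (Finset.univ : Finset (Fin s))).card = if x ∈ A then s - 1 else s := by
          intro x
          split_ifs <;> simp
        simp only [this]
        rw [Finset.prod_ite]
        simp only [Finset.prod_const]
        have e1 : (Finset.univ.filter fun x : V => x ∈ A) = A := by ext; simp
        have e2 : (Finset.univ.filter fun x : V => x ∉ A) = Aᶜ := by ext; simp
        rw [e1, e2, Finset.card_compl, hA, hV]
      rw [Finset.prod_congr rfl fun i _ => this i]
      simp
    rw [this, mul_pow, ← pow_mul, ← pow_mul, mul_assoc, ← pow_add, ← add_mul,
      Nat.sub_add_cancel hle]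
  have hcover : (Finset.univ : Finset (V × Fin r → Fin s)) ⊆
      ((Finset.univ : Finset V).powersetCard (C * p) ×ˢ
        (Finset.univ : Finset (Fin r × ZMod p → Fin s))).biUnion fun x => B x.1 x.2 := by
    intro c _
    obtain ⟨A, hA, hfree⟩ := hcon c
    obtain ⟨e, he⟩ := er_missing v c A hfree
    rw [Finset.mem_biUnion]
    refine ⟨(A, e), ?_, ?_⟩
    · simp [Finset.mem_powersetCard, hA]
    · simp only [B, Fintype.mem_piFinset]
      intro x
      by_cases hx : x.1 ∈ A
      · simp only [hx, if_true]
        simp only [Finset.mem_erase, Finset.mem_univ, and_true]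
        exact he x.1 hx x.2
      · simp [hx]
  have hcard := (Finset.card_le_card hcover).trans Finset.card_biUnion_le
  have hs1 : 0 < s := by omega
  have hbig : s ^ (p * p * r) * s ^ (C * p * r) ≤
      (p * p) ^ (C * p) * s ^ (r * p) * ((s - 1) ^ (C * p * r) * s ^ (p * p * r)) := by
    have e1 : (Finset.univ : Finset (V × Fin r → Fin s)).card = s ^ (p * p * r) := by
      rw [Finset.card_univ]; simp [hV]
    rw [e1] at hcard
    calc _ ≤ (∑ x ∈ ((Finset.univ : Finset V).powersetCard (C * p) ×ˢ
        (Finset.univ : Finset (Fin r × ZMod p → Fin s))), (B x.1 x.2).card) * s ^ (C * p * r) :=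
          Nat.mul_le_mul_right _ hcard
      _ = ∑ x ∈ ((Finset.univ : Finset V).powersetCard (C * p) ×ˢ
        (Finset.univ : Finset (Fin r × ZMod p → Fin s))),
          ((s - 1) ^ (C * p * r) * s ^ (p * p * r)) := by
          rw [Finset.sum_mul]
          refine Finset.sum_congr rfl fun x hx => hB _ _ ?_
          rw [Finset.mem_product, Finset.mem_powersetCard] at hx
          exact hx.1.2
      _ = ((p * p).choose (C * p) * s ^ (r * p)) * ((s - 1) ^ (C * p * r) * s ^ (p * p * r)) := by
          rw [Finset.sum_const, smul_eq_mul, Finset.card_product, Finset.card_powersetCard,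
            Finset.card_univ, hV, Finset.card_univ]
          simp [ZMod.card]
      _ ≤ _ := by
          gcongr
          exact Nat.choose_le_pow _ _
  have h3 : s ^ (C * p * r) ≤ (p * p) ^ (C * p) * s ^ (r * p) * (s - 1) ^ (C * p * r) := by
    have : 0 < s ^ (p * p * r) := by positivity
    refine Nat.le_of_mul_le_mul_left (c := s ^ (p * p * r)) ?_ this
    refine hbig.trans (le_of_eq (by ring))
  have h4 : (2 ^ r) ^ p * ((s * (s - 1) ^ C) ^ r) ^ p ≤
      (p ^ (2 * C)) ^ p * ((s * (s - 1) ^ C) ^ r) ^ p := by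
    calc (2 ^ r) ^ p * ((s * (s - 1) ^ C) ^ r) ^ p = ((2 * s * (s - 1) ^ C) ^ r) ^ p := by
          rw [← mul_pow, ← mul_pow, mul_assoc]
      _ ≤ ((s ^ C) ^ r) ^ p := by gcongr
      _ = s ^ (C * p * r) := by rw [← pow_mul, ← pow_mul]; congr 1; ring
      _ ≤ _ := h3
      _ = _ := by
          rw [mul_pow s, mul_pow (s ^ r), ← pow_two, ← pow_mul, ← pow_mul, ← pow_mul, ← pow_mul,
            ← pow_mul, show 2 * (C * p) = 2 * C * p by ring, show C * p * r = C * (r * p) by ring]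
          exact mul_assoc _ _ _
  have hpos : 0 < ((s * (s - 1) ^ C) ^ r) ^ p := by
    have : 0 < s - 1 := by omega
    positivity
  have h5 := Nat.le_of_mul_le_mul_right h4 hpos
  have h6 := Nat.pow_lt_pow_left h2 hp0.ne'
  omega

lemma er_poly_lt (K d : ℕ) : ∃ L0, ∀ L ≥ L0, K * (L + 1) ^ d < 2 ^ L := by
  have h := tendsto_pow_const_div_const_pow_of_one_lt d (r := (2 : ℝ)) (by norm_num)
  have h' := (Filter.tendsto_add_atTop_iff_nat 1).2 h
  have h2 : ∀ᶠ n : ℕ in Filter.atTop,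
      (((n + 1 : ℕ) : ℝ) ^ d / 2 ^ (n + 1)) < 1 / (2 * (K + 1)) :=
    h'.eventually (gt_mem_nhds (by positivity))
  obtain ⟨L0, hL0⟩ := Filter.eventually_atTop.1 h2
  refine ⟨L0, fun L hL => ?_⟩
  have := hL0 L hL
  rw [div_lt_div_iff₀ (by positivity) (by positivity)] at this
  have h3 : (K : ℝ) * ((L : ℝ) + 1) ^ d < 2 ^ L := by
    push_cast at this
    rw [pow_succ (2 : ℝ) L] at this
    have : (0 : ℝ) ≤ ((L : ℝ) + 1) ^ d := by positivity
    nlinarith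
  exact_mod_cast h3

lemma er_exists_C {s : ℕ} (hs : 2 ≤ s) : ∃ C : ℕ, 0 < C ∧ 2 * s * (s - 1) ^ C ≤ s ^ C := by
  have hs0 : (0 : ℝ) < s := by exact_mod_cast (by omega : 0 < s)
  have h1 : ((s - 1 : ℕ) : ℝ) / s < 1 := by
    rw [div_lt_one hs0]; exact_mod_cast (by omega : s - 1 < s)
  obtain ⟨C, hC⟩ := exists_pow_lt_of_lt_one (show (0 : ℝ) < 1 / (2 * s) by positivity) h1
  rw [div_pow, div_lt_div_iff₀ (by positivity) (by positivity)] at hC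
  have h2 : 2 * s * (s - 1) ^ C ≤ s ^ C := by
    have : (2 : ℝ) * s * ((s - 1 : ℕ) : ℝ) ^ C ≤ s ^ C := by linarith
    exact_mod_cast this
  refine ⟨C, ?_, h2⟩
  rcases Nat.eq_zero_or_pos C with h | h
  · subst h; simp at h2; omega
  · exact h

lemma er_construct {s : ℕ} (hs : 2 ≤ s) : ∃ C p0 : ℕ, 0 < C ∧ ∀ p, p.Prime → p0 ≤ p →
    ∃ G : SimpleGraph (ZMod p × ZMod p), G.CliqueFree (s + 2) ∧
      ∀ A : Finset (ZMod p × ZMod p), A.card = C * p → ¬ G.CliqueFreeOn A s := by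
  obtain ⟨C, hC0, hC⟩ := er_exists_C hs
  obtain ⟨L0, hL0⟩ := er_poly_lt (4 * (2 * C) ^ 6) 6
  refine ⟨C, max 3 (2 ^ L0), hC0, fun p hp hpp => ?_⟩
  have : Fact p.Prime := ⟨hp⟩
  have hp3 : 2 < p := lt_of_lt_of_le (by norm_num) ((le_max_left _ _).trans hpp)
  have hpL : 2 ^ L0 ≤ p := (le_max_right _ _).trans hpp
  let L := Nat.log 2 p
  have hL : L0 ≤ L := Nat.le_log_of_pow_le (by norm_num) hpL
  have h2L : 2 ^ L ≤ p := Nat.pow_log_le_self 2 (by omega)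
  have hL2 : p < 2 ^ (L + 1) := Nat.lt_pow_succ_log_self (by norm_num) p
  let r := 2 * C * (L + 1)
  have hr1 : 1 ≤ r := by
    have : 0 < 2 * C * (L + 1) := by positivity
    exact this
  have hr : 3 * r ^ 6 + r ^ 2 < p := by
    have h1 : r ^ 2 ≤ r ^ 6 := Nat.pow_le_pow_right hr1 (by norm_num)
    have h2 : 4 * r ^ 6 = 4 * (2 * C) ^ 6 * (L + 1) ^ 6 := by
      simp only [r]; ring
    have := hL0 L hL
    omega
  obtain ⟨v, vinj, hv⟩ := er_slopes (r := r) hp3 hr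
  have h2 : p ^ (2 * C) < 2 ^ r := by
    have := Nat.pow_lt_pow_left hL2 (show 2 * C ≠ 0 by omega)
    rw [← pow_mul] at this
    have e : (L + 1) * (2 * C) = r := by simp only [r]; ring
    rwa [e] at this
  obtain ⟨c, hc⟩ := er_count (r := r) hs v h2 hC
  exact ⟨erGraph v c, er_cliqueFree hs v vinj hv c, hc⟩

lemma er_le {s t n m : ℕ} (G : SimpleGraph (Fin n)) (hG : G.CliqueFree t)
    (h : ∀ A : Finset (Fin n), G.CliqueFreeOn A s → A.card ≤ m) : erdosRogers s t n ≤ m := by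
  unfold erdosRogers
  refine le_trans (Nat.sInf_le ⟨G, hG, rfl⟩) (csSup_le' ?_)
  rintro k ⟨A, rfl, hA⟩
  exact h A ((SimpleGraph.cliqueFree_induce_iff ..).1 hA)

lemma er_ge {s t n m : ℕ} (ht : 2 ≤ t) (h : ∀ G : SimpleGraph (Fin n), G.CliqueFree t →
      ∃ A : Finset (Fin n), m ≤ A.card ∧ G.CliqueFreeOn A s) : m ≤ erdosRogers s t n := by
  refine le_csInf ⟨_, ⊥, SimpleGraph.cliqueFree_bot ht, rfl⟩ ?_
  rintro k ⟨G, hG, rfl⟩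
  obtain ⟨A, hA, hA'⟩ := h G hG
  refine hA.trans (le_csSup ⟨n, ?_⟩ ⟨A, rfl, (SimpleGraph.cliqueFree_induce_iff ..).2 hA'⟩)
  rintro k ⟨A, rfl, -⟩
  simpa using Finset.card_le_univ A

lemma er_upper {s : ℕ} (hs : 2 ≤ s) : ∃ C n0 : ℕ, 0 < C ∧ ∀ n ≥ n0,
    erdosRogers s (s + 2) n ≤ C * Nat.sqrt n := by
  classical
  obtain ⟨C, p0, hC, h⟩ := er_construct hs
  refine ⟨4 * C, max 1 (p0 ^ 2), by omega, fun n hn => ?_⟩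
  have hn1 : 1 ≤ n := (le_max_left _ _).trans hn
  have hn2 : p0 ^ 2 ≤ n := (le_max_right _ _).trans hn
  have hq : 1 ≤ Nat.sqrt n := Nat.le_sqrt.2 (by omega)
  have hq2 : p0 ≤ Nat.sqrt n := Nat.le_sqrt.2 (by nlinarith)
  obtain ⟨p, hp, hp1, hp2⟩ := Nat.exists_prime_lt_and_le_two_mul (Nat.sqrt n + 1) (by omega)
  obtain ⟨G, hG, hA⟩ := h p hp (by omega)
  have : Fact p.Prime := ⟨hp⟩
  have hcard : Fintype.card (Fin n) ≤ Fintype.card (ZMod p × ZMod p) := by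
    simp only [Fintype.card_fin, Fintype.card_prod, ZMod.card]
    have := Nat.lt_succ_sqrt n
    have : (Nat.sqrt n).succ * (Nat.sqrt n).succ ≤ p * p := Nat.mul_le_mul (by omega) (by omega)
    omega
  obtain ⟨f⟩ := Function.Embedding.nonempty_of_card_le hcard
  have hm : C * p ≤ 4 * C * Nat.sqrt n := by nlinarith
  refine (er_le (G.comap f) (hG.comap ⟨(SimpleGraph.Embedding.comap f G).toCopy⟩) (m := C * p) ?_).trans hm
  intro A hfree
  by_contra hlt
  push Not at hlt
  obtain ⟨B, hBA, hB⟩ := Finset.exists_subset_card_eq hlt.le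
  apply hA (B.map f) (by simpa using hB)
  intro t ht hcl
  have htm : t ⊆ B.map f := by exact_mod_cast ht
  obtain ⟨u, hu, rfl⟩ := Finset.subset_map_iff.1 htm
  refine hfree (t := u) (by exact_mod_cast hu.trans hBA) ⟨?_, by simpa using hcl.2⟩
  intro x hx y hy hxy
  exact hcl.1 (by simpa using hx) (by simpa using hy) (fun h => hxy (f.injective h))

open Classical in
/-- The independent subsets of `S`. -/
noncomputable def erInd {V : Type*} (G : SimpleGraph V) (S : Finset V) : Finset (Finset V) :=
  S.powerset.filter fun B => ∀ x ∈ B, ∀ y ∈ B, ¬ G.Adj x y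

lemma er_mem_ind {V : Type*} {G : SimpleGraph V} {S B : Finset V} :
    B ∈ erInd G S ↔ B ⊆ S ∧ ∀ x ∈ B, ∀ y ∈ B, ¬ G.Adj x y := by
  simp [erInd]

lemma er_empty_mem {V : Type*} {G : SimpleGraph V} {S : Finset V} : ∅ ∈ erInd G S := by
  simp [er_mem_ind]

lemma er_ramsey {V : Type*} (G : SimpleGraph V) (k : ℕ) : ∀ (R : ℕ) (S : Finset V),
    G.CliqueFreeOn S (R + 1) → (∀ B ∈ erInd G S, B.card ≤ k) → S.card < (k + 1) ^ R := by
  classical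
  intro R
  induction R with
  | zero =>
    intro S hS _
    have : S = ∅ := by
      by_contra hne
      obtain ⟨x, hx⟩ := Finset.nonempty_iff_ne_empty.2 hne
      exact hS (t := {x}) (by simpa using hx) ⟨by simp, by simp⟩
    simp [this]
  | succ R ih =>
    intro S hS hk
    obtain ⟨T, hT, hmax⟩ := Finset.exists_max_image (erInd G S) Finset.card ⟨∅, er_empty_mem⟩
    obtain ⟨hTS, hTi⟩ := er_mem_ind.1 hT
    have hcov : S ⊆ T.biUnion fun t => insert t (S.filter fun u => G.Adj t u) := by
      intro u hu
      rw [Finset.mem_biUnion]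
      by_contra hcon
      push Not at hcon
      have huT : u ∉ T := fun h => hcon u h (Finset.mem_insert_self _ _)
      have hna : ∀ t ∈ T, ¬ G.Adj t u := fun t ht h =>
        hcon t ht (Finset.mem_insert_of_mem (Finset.mem_filter.2 ⟨hu, h⟩))
      have hmem : insert u T ∈ erInd G S := by
        rw [er_mem_ind]
        refine ⟨Finset.insert_subset hu hTS, ?_⟩
        intro x hx y hy
        rw [Finset.mem_insert] at hx hy
        rcases hx with rfl | hx <;> rcases hy with rfl | hy
        · exact G.irrefl
        · exact fun h => hna y hy h.symm
        · exact hna x hx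
        · exact hTi x hx y hy
      have := hmax _ hmem
      rw [Finset.card_insert_of_notMem huT] at this
      omega
    have hnb : ∀ t ∈ T, (insert t (S.filter fun u => G.Adj t u)).card ≤ (k + 1) ^ R := by
      intro t ht
      refine (Finset.card_insert_le _ _).trans ?_
      have : (S.filter fun u => G.Adj t u).card < (k + 1) ^ R := by
        apply ih
        · refine SimpleGraph.CliqueFreeOn.subset G ?_ (SimpleGraph.CliqueFreeOn.of_succ G hS (hTS ht))
          intro x hx
          simpa using hx
        · intro B hB
          apply hk
          rw [er_mem_ind] at hB ⊢
          exact ⟨hB.1.trans (Finset.filter_subset _ _), hB.2⟩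
      omega
    have h1 := (Finset.card_le_card hcov).trans (Finset.card_biUnion_le_card_mul _ _ _ hnb)
    have h2 : T.card ≤ k := hk T hT
    have h3 : T.card * (k + 1) ^ R ≤ k * (k + 1) ^ R := Nat.mul_le_mul_right _ h2
    have h4 : 0 < (k + 1) ^ R := by positivity
    rw [pow_succ]
    nlinarith

lemma er_avg (g R : ℕ) : ∃ M : ℕ, ∀ (V : Type) (G : SimpleGraph V) (S : Finset V),
    G.CliqueFreeOn S (R + 1) → M < (erInd G S).card →
      g * (erInd G S).card ≤ ∑ B ∈ erInd G S, B.card := by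
  classical
  obtain ⟨L0, hL0⟩ := er_poly_lt (2 * (2 * g)) (R * (2 * g))
  refine ⟨2 ^ ((L0 + 1) ^ R), fun V G S hS hM => ?_⟩
  obtain ⟨T, hT, hmax⟩ := Finset.exists_max_image (erInd G S) Finset.card ⟨∅, er_empty_mem⟩
  obtain ⟨hTS, hTi⟩ := er_mem_ind.1 hT
  have hram := er_ramsey G T.card R S hS hmax
  have hIS : (erInd G S).card ≤ 2 ^ S.card := by
    rw [← Finset.card_powerset]
    exact Finset.card_le_card (Finset.filter_subset _ _)
  have h1 : (L0 + 1) ^ R < S.card :=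
    (Nat.pow_lt_pow_iff_right (by norm_num : 1 < 2)).1 (hM.trans_le hIS)
  have h2 : L0 ≤ T.card := by
    by_contra hlt
    have : (T.card + 1) ^ R ≤ (L0 + 1) ^ R := Nat.pow_le_pow_left (by omega) R
    omega
  have hbig := hL0 T.card h2
  have hTI : 2 ^ T.card ≤ (erInd G S).card := by
    rw [← Finset.card_powerset]
    refine Finset.card_le_card fun B hB => ?_
    rw [Finset.mem_powerset] at hB
    exact er_mem_ind.2 ⟨hB.trans hTS, fun x hx y hy => hTi x (hB hx) y (hB hy)⟩
  let small := (erInd G S).filter fun B => B.card < 2 * g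
  have hsmall : small.card ≤ 2 * g * (T.card + 1) ^ (R * (2 * g)) := by
    have hsub : small ⊆ (Finset.range (2 * g)).biUnion fun i => S.powersetCard i := by
      intro B hB
      obtain ⟨hB1, hB2⟩ := Finset.mem_filter.1 hB
      rw [Finset.mem_biUnion]
      exact ⟨B.card, Finset.mem_range.2 hB2,
        Finset.mem_powersetCard.2 ⟨(er_mem_ind.1 hB1).1, rfl⟩⟩
    refine (Finset.card_le_card hsub).trans ?_
    have := Finset.card_biUnion_le_card_mul (Finset.range (2 * g)) (fun i => S.powersetCard i)
      ((T.card + 1) ^ (R * (2 * g))) (by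
        intro i hi
        rw [Finset.mem_range] at hi
        rw [Finset.card_powersetCard, pow_mul]
        refine (Nat.choose_le_pow _ _).trans ?_
        have h0 : 0 < (T.card + 1) ^ R := by positivity
        exact (Nat.pow_le_pow_left hram.le i).trans (Nat.pow_le_pow_right h0 hi.le))
    simpa using this
  have hsplit := Finset.card_filter_add_card_filter_not (s := erInd G S) (fun B => B.card < 2 * g)
  have hsum : 2 * g * ((erInd G S).filter fun B => ¬ B.card < 2 * g).card ≤
      ∑ B ∈ erInd G S, B.card := by
    calc _ = ∑ B ∈ (erInd G S).filter fun B => ¬ B.card < 2 * g, 2 * g := by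
          rw [Finset.sum_const, smul_eq_mul, mul_comm]
      _ ≤ ∑ B ∈ (erInd G S).filter fun B => ¬ B.card < 2 * g, B.card := by
          refine Finset.sum_le_sum fun B hB => ?_
          have := (Finset.mem_filter.1 hB).2
          omega
      _ ≤ _ := Finset.sum_le_sum_of_subset (Finset.filter_subset _ _)
  refine le_trans ?_ hsum
  have : (erInd G S).card ≤ 2 * ((erInd G S).filter fun B => ¬ B.card < 2 * g).card := by
    have : 2 * small.card ≤ (erInd G S).card := by nlinarith
    simp only [small] at this
    omega
  nlinarith

open Classical in
lemma er_fibre (R g : ℕ) : ∃ D0 : ℕ, ∀ D ≥ D0, ∀ (V : Type) [Fintype V] (G : SimpleGraph V),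
    G.CliqueFree (R + 2) → ∀ v : V, g * (erInd G Finset.univ).card ≤
      ∑ W ∈ erInd G Finset.univ, ((if v ∈ W then D else 0) + (W.filter fun u => G.Adj v u).card) := by
  obtain ⟨M, hM⟩ := er_avg (2 * g) R
  refine ⟨g * (1 + M), fun D hD V _ G hG v => ?_⟩
  let φ : Finset V → Finset V := fun W => W.filter fun u => u ≠ v ∧ ¬ G.Adj v u
  let I := erInd G Finset.univ
  have e1 : I.card = ∑ A : Finset V, (I.filter fun W => φ W = A).card := by
    have := Finset.sum_fiberwise I φ (fun _ => 1)
    simp only [Finset.sum_const, smul_eq_mul, mul_one] at this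
    exact this.symm
  change g * I.card ≤ ∑ W ∈ I, _
  rw [← Finset.sum_fiberwise I φ, e1, Finset.mul_sum]
  refine Finset.sum_le_sum fun A _ => ?_
  rcases Finset.eq_empty_or_nonempty (I.filter fun W => φ W = A) with h0 | ⟨W0, hW0⟩
  · rw [h0]; simp
  obtain ⟨hW0I, hW0A⟩ := Finset.mem_filter.1 hW0
  have hA1 : ∀ a ∈ A, a ≠ v ∧ ¬ G.Adj v a := by
    intro a ha
    rw [← hW0A] at ha
    exact (Finset.mem_filter.1 ha).2
  have hA2 : ∀ a ∈ A, ∀ b ∈ A, ¬ G.Adj a b := by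
    intro a ha b hb
    rw [← hW0A] at ha hb
    exact (er_mem_ind.1 hW0I).2 a (Finset.mem_filter.1 ha).1 b (Finset.mem_filter.1 hb).1
  let X : Finset V := Finset.univ.filter fun u => G.Adj v u ∧ ∀ a ∈ A, ¬ G.Adj u a
  have hXmem : ∀ u, u ∈ X ↔ G.Adj v u ∧ ∀ a ∈ A, ¬ G.Adj u a := by intro u; simp [X]
  have hXfree : G.CliqueFreeOn X (R + 1) := by
    have := SimpleGraph.CliqueFreeOn.of_succ G (hG.cliqueFreeOn (s := Set.univ)) (Set.mem_univ v)
    refine SimpleGraph.CliqueFreeOn.subset G ?_ this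
    intro x hx
    have := (hXmem x).1 hx
    simpa using this.1
  have hsub : (I.filter fun W => φ W = A) ⊆ insert (insert v A) ((erInd G X).image fun B => A ∪ B) := by
    intro W hW
    obtain ⟨hWI, hWA⟩ := Finset.mem_filter.1 hW
    have hWi := (er_mem_ind.1 hWI).2
    have hAW : ∀ u, u ∈ A ↔ u ∈ W ∧ u ≠ v ∧ ¬ G.Adj v u := by
      intro u; rw [← hWA]; simp [φ]
    rw [Finset.mem_insert, Finset.mem_image]
    by_cases hv : v ∈ W
    · left
      ext u
      rw [Finset.mem_insert, hAW]
      constructor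
      · intro hu
        by_cases huv : u = v
        · exact Or.inl huv
        · exact Or.inr ⟨hu, huv, hWi v hv u hu⟩
      · rintro (rfl | h)
        · exact hv
        · exact h.1
    · right
      refine ⟨W.filter fun u => G.Adj v u, ?_, ?_⟩
      · rw [er_mem_ind]
        refine ⟨?_, fun x hx y hy => hWi x (Finset.mem_filter.1 hx).1 y (Finset.mem_filter.1 hy).1⟩
        intro u hu
        obtain ⟨hu1, hu2⟩ := Finset.mem_filter.1 hu
        exact (hXmem u).2 ⟨hu2, fun a ha => hWi u hu1 a ((hAW a).1 ha).1⟩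
      · ext u
        rw [Finset.mem_union, hAW, Finset.mem_filter]
        constructor
        · rintro (h | h)
          · exact h.1
          · exact h.1
        · intro hu
          by_cases h : G.Adj v u
          · exact Or.inr ⟨hu, h⟩
          · exact Or.inl ⟨hu, fun h' => hv (h' ▸ hu), h⟩
  have hcard : (I.filter fun W => φ W = A).card ≤ 1 + (erInd G X).card := by
    refine (Finset.card_le_card hsub).trans ((Finset.card_insert_le _ _).trans ?_)
    have := Finset.card_image_le (s := erInd G X) (f := fun B => A ∪ B)
    omega
  have hdisj : ∀ B ∈ erInd G X, ∀ u ∈ B, u ∉ A := by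
    intro B hB u hu huA
    exact (hA1 u huA).2 ((hXmem u).1 ((er_mem_ind.1 hB).1 hu)).1
  by_cases hcase : (erInd G X).card ≤ M
  · have hmem : insert v A ∈ I.filter fun W => φ W = A := by
      rw [Finset.mem_filter]
      refine ⟨er_mem_ind.2 ⟨Finset.subset_univ _, ?_⟩, ?_⟩
      · intro x hx y hy
        rw [Finset.mem_insert] at hx hy
        rcases hx with rfl | hx <;> rcases hy with rfl | hy
        · exact G.irrefl
        · exact (hA1 y hy).2
        · exact fun h => (hA1 x hx).2 h.symm
        · exact hA2 x hx y hy
      · ext u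
        simp only [φ, Finset.mem_filter, Finset.mem_insert]
        constructor
        · rintro ⟨h | h, h'⟩
          · exact absurd h h'.1
          · exact h
        · intro h
          exact ⟨Or.inr h, hA1 u h⟩
    have h1 := Finset.single_le_sum (f := fun W : Finset V => (if v ∈ W then D else 0) +
      (W.filter fun u => G.Adj v u).card) (fun _ _ => Nat.zero_le _) hmem
    simp only [Finset.mem_insert_self, if_true] at h1
    have h2 : g * (I.filter fun W => φ W = A).card ≤ g * (1 + M) := Nat.mul_le_mul_left _ (by omega)
    omega
  · push Not at hcase
    have h1 := hM V G X hXfree hcase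
    have hsup : ((erInd G X).image fun B => A ∪ B) ⊆ I.filter fun W => φ W = A := by
      intro W hW
      obtain ⟨B, hB, rfl⟩ := Finset.mem_image.1 hW
      obtain ⟨hBX, hBi⟩ := er_mem_ind.1 hB
      rw [Finset.mem_filter]
      refine ⟨er_mem_ind.2 ⟨Finset.subset_univ _, ?_⟩, ?_⟩
      · intro x hx y hy
        rw [Finset.mem_union] at hx hy
        rcases hx with hx | hx <;> rcases hy with hy | hy
        · exact hA2 x hx y hy
        · exact fun h => ((hXmem y).1 (hBX hy)).2 x hx h.symm
        · exact ((hXmem x).1 (hBX hx)).2 y hy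
        · exact hBi x hx y hy
      · ext u
        simp only [φ, Finset.mem_filter, Finset.mem_union]
        constructor
        · rintro ⟨h | h, h'⟩
          · exact h
          · exact absurd ((hXmem u).1 (hBX h)).1 h'.2
        · intro h
          exact ⟨Or.inl h, hA1 u h⟩
    have hinj : Set.InjOn (fun B => A ∪ B) (erInd G X : Set (Finset V)) := by
      intro B hB B' hB' h
      have h : A ∪ B = A ∪ B' := h
      ext u
      constructor
      · intro hu
        have : u ∈ A ∪ B' := h ▸ Finset.mem_union_right _ hu
        exact (Finset.mem_union.1 this).resolve_left (hdisj B hB u hu)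
      · intro hu
        have : u ∈ A ∪ B := h ▸ Finset.mem_union_right _ hu
        exact (Finset.mem_union.1 this).resolve_left (hdisj B' hB' u hu)
    have h2 : ∑ B ∈ erInd G X, B.card ≤ ∑ W ∈ I.filter (fun W => φ W = A),
        ((if v ∈ W then D else 0) + (W.filter fun u => G.Adj v u).card) := by
      refine le_trans ?_ (Finset.sum_le_sum_of_subset hsup)
      rw [Finset.sum_image hinj]
      refine Finset.sum_le_sum fun B hB => ?_
      refine le_trans (Finset.card_le_card ?_) (Nat.le_add_left _ _)
      intro u hu
      rw [Finset.mem_filter]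
      exact ⟨Finset.mem_union_right _ hu, ((hXmem u).1 ((er_mem_ind.1 hB).1 hu)).1⟩
    have h3 : 1 ≤ (erInd G X).card := Finset.card_pos.2 ⟨∅, er_empty_mem⟩
    have h4 : g * (I.filter fun W => φ W = A).card ≤ g * (2 * (erInd G X).card) :=
      Nat.mul_le_mul_left _ (by omega)
    nlinarith

lemma er_indep (R g : ℕ) : ∃ D0 : ℕ, ∀ D ≥ D0, ∀ (V : Type) [Fintype V] (G : SimpleGraph V),
    G.CliqueFree (R + 2) →
    (∀ (v : V) (N : Finset V), (∀ u ∈ N, G.Adj v u) → N.card ≤ D) →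
    ∃ W ∈ erInd G Finset.univ, g * Fintype.card V ≤ 2 * D * W.card := by
  classical
  obtain ⟨D0, h⟩ := er_fibre R g
  refine ⟨D0, fun D hD V _ G hG hdeg => ?_⟩
  have h1 := Finset.sum_le_sum fun v (_ : v ∈ (Finset.univ : Finset V)) => h D hD V G hG v
  by_contra hcon
  push Not at hcon
  rw [Finset.sum_comm] at h1
  have h2 : ∀ W ∈ erInd G Finset.univ, ∑ v : V, ((if v ∈ W then D else 0) +
      (W.filter fun u => G.Adj v u).card) < g * Fintype.card V := by
    intro W hW
    refine lt_of_le_of_lt ?_ (hcon W hW)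
    rw [Finset.sum_add_distrib]
    have e1 : ∑ v : V, (if v ∈ W then D else 0) = D * W.card := by
      rw [Finset.sum_ite_mem, Finset.univ_inter, Finset.sum_const, smul_eq_mul, mul_comm]
    have e2 : ∑ v : V, (W.filter fun u => G.Adj v u).card ≤ D * W.card := by
      simp only [Finset.card_filter]
      rw [Finset.sum_comm]
      have : ∀ u ∈ W, ∑ v : V, (if G.Adj v u then 1 else 0) ≤ D := by
        intro u _
        rw [← Finset.card_filter]
        apply hdeg u
        intro x hx
        exact ((Finset.mem_filter.1 hx).2).symm
      refine (Finset.sum_le_sum this).trans (le_of_eq ?_)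
      rw [Finset.sum_const, smul_eq_mul, mul_comm]
    rw [e1]
    linarith
  have h3 := Finset.sum_lt_sum_of_nonempty (s := erInd G (Finset.univ : Finset V))
    ⟨∅, er_empty_mem⟩ h2
  have h4 := h1.trans_lt h3
  simp only [Finset.sum_const, smul_eq_mul, Finset.card_univ] at h4
  have : Fintype.card V * (g * (erInd G Finset.univ).card) =
    (erInd G Finset.univ).card * (g * Fintype.card V) := by ring
  omega

lemma er_lower {s : ℕ} (hs : 1 ≤ s) (K : ℕ) : ∃ n0 : ℕ, ∀ n ≥ n0,
    K * Nat.sqrt n ≤ erdosRogers (s + 1) (s + 2) n := by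
  classical
  rcases Nat.eq_zero_or_pos K with rfl | hK
  · exact ⟨0, fun n _ => by simp⟩
  obtain ⟨D0, hD0⟩ := er_indep s (2 * K ^ 2)
  refine ⟨max 1 (D0 ^ 2), fun n hn => er_ge (by omega) fun G hG => ?_⟩
  have hn1 : 1 ≤ n := (le_max_left _ _).trans hn
  have hn2 : D0 ^ 2 ≤ n := (le_max_right _ _).trans hn
  have hq : 1 ≤ Nat.sqrt n := Nat.le_sqrt.2 (by omega)
  have hq2 : D0 ≤ Nat.sqrt n := Nat.le_sqrt.2 (by nlinarith)
  by_cases hdeg : ∀ (v : Fin n) (N : Finset (Fin n)), (∀ u ∈ N, G.Adj v u) →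
      N.card ≤ K * Nat.sqrt n
  · obtain ⟨W, hW, hWc⟩ := hD0 (K * Nat.sqrt n) (by nlinarith) (Fin n) G hG hdeg
    refine ⟨W, ?_, ?_⟩
    · rw [Fintype.card_fin] at hWc
      have hsq : Nat.sqrt n * Nat.sqrt n ≤ n := Nat.sqrt_le n
      have h1 : 2 * K * Nat.sqrt n * (K * Nat.sqrt n) ≤ 2 * K * Nat.sqrt n * W.card := by
        calc _ = 2 * K ^ 2 * (Nat.sqrt n * Nat.sqrt n) := by ring
          _ ≤ 2 * K ^ 2 * n := Nat.mul_le_mul_left _ hsq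
          _ ≤ _ := hWc
          _ = _ := by ring
      exact Nat.le_of_mul_le_mul_left h1 (by positivity)
    · refine SimpleGraph.CliqueFreeOn.mono G (m := 2) (by omega) ?_
      rw [SimpleGraph.cliqueFreeOn_two]
      intro x hx y hy _
      exact (er_mem_ind.1 hW).2 x hx y hy
  · push Not at hdeg
    obtain ⟨v, N, hN, hlt⟩ := hdeg
    refine ⟨N, hlt.le, ?_⟩
    have := SimpleGraph.CliqueFreeOn.of_succ G (hG.cliqueFreeOn (s := Set.univ)) (Set.mem_univ v)
    refine SimpleGraph.CliqueFreeOn.subset G ?_ this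
    intro x hx
    simpa using hN x hx

/-- For every integer `s ≥ 3`, the ratio `f_{s+1,s+2}(n)/f_{s,s+2}(n)` tends to infinity
as `n → ∞`. -/
theorem erdosRogers_ratio_tendsto_atTop_sPlusTwo (s : ℕ) (hs : 3 ≤ s) :
    Filter.Tendsto
      (fun n : ℕ => (erdosRogers (s + 1) (s + 2) n : ℝ) / (erdosRogers s (s + 2) n : ℝ))
      Filter.atTop Filter.atTop := by
  obtain ⟨C, n0, hC, hup⟩ := er_upper (s := s) (by omega)
  rw [Filter.tendsto_atTop]
  intro b
  obtain ⟨k, hk⟩ := exists_nat_ge b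
  obtain ⟨n1, hlow⟩ := er_lower (s := s) (by omega) (k * C)
  filter_upwards [Filter.eventually_ge_atTop (max 1 (max n0 n1))] with n hn
  have hn1 : 1 ≤ n := (le_max_left _ _).trans hn
  have hn2 : n0 ≤ n := (le_max_left _ _).trans ((le_max_right _ _).trans hn)
  have hn3 : n1 ≤ n := (le_max_right _ _).trans ((le_max_right _ _).trans hn)
  have h1 := hup n hn2
  have h2 := hlow n hn3
  have hpos : 1 ≤ erdosRogers s (s + 2) n := by
    refine er_ge (by omega) fun G _ => ⟨{⟨0, by omega⟩}, by simp, ?_⟩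
    apply SimpleGraph.cliqueFreeOn_of_card_lt
    simp; omega
  have hpos' : (0 : ℝ) < (erdosRogers s (s + 2) n : ℝ) := by exact_mod_cast hpos
  refine hk.trans ?_
  rw [le_div_iff₀ hpos']
  have h3 : k * erdosRogers s (s + 2) n ≤ erdosRogers (s + 1) (s + 2) n := by
    calc _ ≤ k * (C * Nat.sqrt n) := Nat.mul_le_mul_left _ h1
      _ = k * C * Nat.sqrt n := by ring
      _ ≤ _ := h2
  exact_mod_cast h3
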